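/- arXiv:2402.12734 — 4 statements merged into one kernel-verified Lean document; each statement's English description precedes it below -/
import Mathlib

section
/- Under the odd-case construction, the cost of the permutation algorithm's matching satisfies C(π_A) ≥ (k-1)(k+1)/2 - ε/8. -/
/-!
Odd-case construction: k ≥ 3 odd, 0 < ε ≤ 1.  Servers s_1,...,s_k at positions
0,...,k-1 (s_i at position i-1).  ε_i = (ε/8)·2^(i-k) for i < k and ε_k = 1/2.
Requests (1-indexed): r_{2j-1} = ((k-1)/2 + j - 1) + 1/2 - ε_{2j-1} for
j = 1,...,(k+1)/2 and r_{2j} = ((k-1)/2 - j) + 1/2 + ε_{2j} for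
j = 1,...,(k-1)/2.  A matching is a function f : ℕ → ℕ sending each request
index i ∈ {1,...,k} to a server index f i ∈ {1,...,k} (at position f i - 1);
its cost is C(f) = ∑_{i=1}^k |r_i - (f i - 1)|.
-/

/-- `ε_i`: equals `(ε/8)·2^(i-k)` for `i < k` and `1/2` for `i = k`. -/
noncomputable def eps (k : ℕ) (ε : ℝ) (i : ℕ) : ℝ :=
  if i = k then 1 / 2 else ε / 8 * (2 : ℝ) ^ ((i : ℤ) - (k : ℤ))

/-- The request `r_i` (1-indexed, `1 ≤ i ≤ k`): writing `i = 2j-1` or `i = 2j`,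
`r_{2j-1} = ((k-1)/2 + j - 1) + 1/2 - ε_{2j-1}` and
`r_{2j} = ((k-1)/2 - j) + 1/2 + ε_{2j}`. -/
noncomputable def req (k : ℕ) (ε : ℝ) (i : ℕ) : ℝ :=
  if i % 2 = 1 then
    (((k : ℝ) - 1) / 2 + (((i + 1) / 2 : ℕ) : ℝ) - 1) + 1 / 2 - eps k ε i
  else (((k : ℝ) - 1) / 2 - ((i / 2 : ℕ) : ℝ)) + 1 / 2 + eps k ε i

/-- Cost of the matching sending request `i` to server `f i` (position `f i - 1`). -/
noncomputable def cost (k : ℕ) (ε : ℝ) (f : ℕ → ℕ) : ℝ :=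
  ∑ i ∈ Finset.Icc 1 k, |req k ε i - ((f i : ℝ) - 1)|

/-- The permutation algorithm's matching `π_A`:
`π_A(2j-1) = (k+1)/2 - j + 1`, `π_A(2j) = (k+1)/2 + j`. -/
def piA (k : ℕ) (i : ℕ) : ℕ :=
  if i % 2 = 1 then (k + 1) / 2 - (i + 1) / 2 + 1 else (k + 1) / 2 + i / 2

/-- The offline matching `π_B`:
`π_B(2j-1) = (k-1)/2 + j`, `π_B(2j) = (k-1)/2 - j + 1`. -/
def piB (k : ℕ) (i : ℕ) : ℕ :=
  if i % 2 = 1 then (k - 1) / 2 + (i + 1) / 2 else (k - 1) / 2 - i / 2 + 1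

/-- A request is at distance at least `i - 1/2 - ε_i` from the server given by `π_A`. -/
theorem le_abs_req_sub_piA {k : ℕ} (hko : Odd k) (ε : ℝ) {i : ℕ} (hi : i ∈ Finset.Icc 1 k) :
    (i : ℝ) - 1 / 2 - eps k ε i ≤ |req k ε i - ((piA k i : ℝ) - 1)| := by
  obtain ⟨m, rfl⟩ := hko
  rw [Finset.mem_Icc] at hi
  rcases Nat.even_or_odd' i with ⟨j, rfl | rfl⟩
  · have hA : piA (2 * m + 1) (2 * j) = m + 1 + j := by
      unfold piA
      rw [if_neg (by omega)]
      omega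
    rw [hA, req, if_neg (by omega), show 2 * j / 2 = j by omega]
    refine le_trans (le_of_eq ?_) (neg_le_abs _)
    push_cast
    ring
  · have hA : piA (2 * m + 1) (2 * j + 1) = m - j + 1 := by
      unfold piA
      rw [if_pos (by omega)]
      omega
    rw [hA, req, if_pos (by omega), show (2 * j + 1 + 1) / 2 = j + 1 by omega]
    refine le_trans (le_of_eq ?_) (le_abs_self _)
    push_cast [Nat.cast_sub (show j ≤ m by omega)]
    ring

theorem sum_Icc_sub_half_sub_mul_two_pow (c : ℝ) (n : ℕ) :
    ∑ i ∈ Finset.Icc 1 n, ((i : ℝ) - 1 / 2 - c * 2 ^ i) =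
      (n : ℝ) ^ 2 / 2 - c * (2 ^ (n + 1) - 2) := by
  induction n with
  | zero => simp
  | succ n ih =>
    rw [Finset.sum_Icc_succ_top (by omega), ih]
    push_cast
    ring

/-- Odd case: C(π_A) ≥ (k-1)(k+1)/2 - ε/8. -/
theorem odd_permCost_lower (k : ℕ) (hk : 3 ≤ k) (hko : Odd k)
    (ε : ℝ) (hε : 0 < ε) (hε1 : ε ≤ 1) :
    cost k ε (piA k) ≥ ((k : ℝ) - 1) * ((k : ℝ) + 1) / 2 - ε / 8 := by
  obtain ⟨n, rfl⟩ : ∃ n, k = n + 1 := ⟨k - 1, by omega⟩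
  refine ge_iff_le.2 (le_trans ?_
    (Finset.sum_le_sum fun i hi => le_abs_req_sub_piA hko ε hi))
  have hlow : ∑ i ∈ Finset.Icc 1 n, ((i : ℝ) - 1 / 2 - eps (n + 1) ε i) =
      ∑ i ∈ Finset.Icc 1 n, ((i : ℝ) - 1 / 2 - ε / 8 / 2 ^ (n + 1) * 2 ^ i) := by
    refine Finset.sum_congr rfl fun i hi => ?_
    have hin := (Finset.mem_Icc.1 hi).2
    rw [eps, if_neg (by omega), zpow_sub₀ two_ne_zero, zpow_natCast, zpow_natCast]
    ring
  have hcancel : ε / 8 / 2 ^ (n + 1) * 2 ^ (n + 1) = ε / 8 :=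
    div_mul_cancel₀ _ (by positivity)
  have hpos : 0 < ε / 8 / 2 ^ (n + 1) := by positivity
  rw [Finset.sum_Icc_succ_top (by omega), hlow, sum_Icc_sub_half_sub_mul_two_pow, eps,
    if_pos rfl, mul_sub, hcancel]
  push_cast
  linarith
end

section
/- Under the odd-case construction, the cost of the permutation algorithm's matching satisfies the exact identity C(π_A) = (k-1)(k+1)/2 - Σ_{i=1}^{k-1} (ε/8)·2^{i-k}. -/
theorem eps_le_half {k i : ℕ} {ε : ℝ} (hε : 0 < ε) (hε1 : ε ≤ 1) (hi : i ≤ k) :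
    eps k ε i ≤ 1 / 2 := by
  unfold eps
  split_ifs
  · exact le_rfl
  · have hpow : (2 : ℝ) ^ ((i : ℤ) - (k : ℤ)) ≤ 1 :=
      zpow_le_one_of_nonpos₀ (by norm_num) (by omega)
    nlinarith

theorem abs_req_sub_piA {k i : ℕ} (hko : Odd k) {ε : ℝ} (hε : 0 < ε) (hε1 : ε ≤ 1)
    (h1i : 1 ≤ i) (hik : i ≤ k) :
    |req k ε i - ((piA k i : ℝ) - 1)| = (i : ℝ) - 1 / 2 - eps k ε i := by
  have heps := eps_le_half hε hε1 hik
  obtain ⟨m, rfl⟩ := hko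
  have hhalf : (2 * m + 1 + 1) / 2 = m + 1 := by omega
  have hi : (1 : ℝ) ≤ i := by exact_mod_cast h1i
  rcases Nat.even_or_odd' i with ⟨j, rfl | rfl⟩
  · have hreq : req (2 * m + 1) ε (2 * j) - ((piA (2 * m + 1) (2 * j) : ℝ) - 1)
        = -(((2 * j : ℕ) : ℝ) - 1 / 2 - eps (2 * m + 1) ε (2 * j)) := by
      have hpi : piA (2 * m + 1) (2 * j) = m + 1 + j := by
        simp [piA, hhalf]
      rw [hpi, req, if_neg (by omega), show 2 * j / 2 = j by omega]
      push_cast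
      ring
    rw [hreq, abs_neg, abs_of_nonneg (by linarith)]
  · have hreq : req (2 * m + 1) ε (2 * j + 1) - ((piA (2 * m + 1) (2 * j + 1) : ℝ) - 1)
        = ((2 * j + 1 : ℕ) : ℝ) - 1 / 2 - eps (2 * m + 1) ε (2 * j + 1) := by
      have hpi : piA (2 * m + 1) (2 * j + 1) + j = m + 1 := by
        rw [piA, if_pos (by omega)]
        omega
      have hpi' : (piA (2 * m + 1) (2 * j + 1) : ℝ) = m + 1 - j :=
        eq_sub_of_add_eq (by exact_mod_cast hpi)
      rw [hpi', req, if_pos (by omega), show (2 * j + 1 + 1) / 2 = j + 1 by omega]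
      push_cast
      ring
    rw [hreq, abs_of_nonneg (by linarith)]

theorem sum_Icc_sub_half (n : ℕ) :
    ∑ i ∈ Finset.Icc 1 n, ((i : ℝ) - 1 / 2) = (n : ℝ) ^ 2 / 2 := by
  induction n with
  | zero => simp
  | succ n ih =>
    rw [Finset.sum_Icc_succ_top (by omega), ih]
    push_cast
    ring

theorem sum_eps {k : ℕ} (hk : 1 ≤ k) (ε : ℝ) :
    ∑ i ∈ Finset.Icc 1 k, eps k ε i =
      ∑ i ∈ Finset.Icc 1 (k - 1), ε / 8 * (2 : ℝ) ^ ((i : ℤ) - (k : ℤ)) + 1 / 2 := by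
  obtain ⟨n, rfl⟩ := Nat.exists_eq_add_of_le' hk
  rw [Finset.sum_Icc_succ_top (by omega), Nat.add_sub_cancel]
  congr 1
  · refine Finset.sum_congr rfl fun i hi => ?_
    rw [Finset.mem_Icc] at hi
    rw [eps, if_neg (by omega)]
  · rw [eps, if_pos rfl]

/-- Odd case: the exact identity C(π_A) = (k-1)(k+1)/2 - ∑_{i=1}^{k-1} (ε/8)·2^(i-k). -/
theorem odd_permCost_eq (k : ℕ) (hk : 3 ≤ k) (hko : Odd k)
    (ε : ℝ) (hε : 0 < ε) (hε1 : ε ≤ 1) :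
    cost k ε (piA k) =
      ((k : ℝ) - 1) * ((k : ℝ) + 1) / 2 -
        ∑ i ∈ Finset.Icc 1 (k - 1), ε / 8 * (2 : ℝ) ^ ((i : ℤ) - (k : ℤ)) := by
  have hterm : cost k ε (piA k) =
      ∑ i ∈ Finset.Icc 1 k, ((i : ℝ) - 1 / 2 - eps k ε i) :=
    Finset.sum_congr rfl fun i hi =>
      abs_req_sub_piA hko hε hε1 (Finset.mem_Icc.mp hi).1 (Finset.mem_Icc.mp hi).2
  rw [hterm, Finset.sum_sub_distrib, sum_Icc_sub_half, sum_eps (by omega)]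
  ring
end

section
/- Under the odd-case construction, the cost of the offline matching satisfies C(π_B) ≤ (k-1)/2 + ε/8; consequently the minimum over all bijections π of C(π) is at most (k-1)/2 + ε/8. -/
theorem eps_of_lt {k i : ℕ} (ε : ℝ) (hi : i < k) : eps k ε i = ε / 8 * ((2 : ℝ) ^ i / 2 ^ k) := by
  rw [eps, if_neg hi.ne, zpow_sub₀ two_ne_zero, zpow_natCast, zpow_natCast]

theorem sum_two_pow_Icc (n : ℕ) : ∑ i ∈ Finset.Icc 1 n, (2 : ℝ) ^ i = 2 ^ (n + 1) - 2 := by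
  induction n with
  | zero => norm_num
  | succ n ih =>
    rw [Finset.sum_Icc_succ_top (by omega), ih]
    ring

theorem sum_eps_le (n : ℕ) {ε : ℝ} (hε : 0 ≤ ε) :
    ∑ i ∈ Finset.Icc 1 n, eps (n + 1) ε i ≤ ε / 8 := by
  have h : ∑ i ∈ Finset.Icc 1 n, eps (n + 1) ε i =
      ε / 8 * ((2 ^ (n + 1) - 2) / 2 ^ (n + 1)) := by
    rw [← sum_two_pow_Icc, Finset.sum_div, Finset.mul_sum]
    refine Finset.sum_congr rfl fun i hi => eps_of_lt ε ?_
    have := (Finset.mem_Icc.1 hi).2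
    omega
  rw [h]
  refine mul_le_of_le_one_right (by positivity) ?_
  rw [div_le_one (by positivity)]
  linarith

/-- In `π_B` every request is matched to the server at distance `1/2 ∓ ε_i`. -/
theorem req_sub_piB (m : ℕ) (ε : ℝ) {i : ℕ} (hi : i ≤ 2 * m + 1) :
    req (2 * m + 1) ε i - ((piB (2 * m + 1) i : ℝ) - 1) =
      if i % 2 = 1 then 1 / 2 - eps (2 * m + 1) ε i else 1 / 2 + eps (2 * m + 1) ε i := by
  have hm : (2 * m + 1 - 1) / 2 = m := by omega
  unfold req piB
  rw [hm]
  split_ifs with h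
  · push_cast
    ring
  · have hle : i / 2 ≤ m := by omega
    push_cast [Nat.cast_sub hle]
    ring

theorem abs_req_sub_piB_le (m : ℕ) {ε : ℝ} (hε : 0 ≤ ε) {i : ℕ} (hi : i < 2 * m + 1) :
    |req (2 * m + 1) ε i - ((piB (2 * m + 1) i : ℝ) - 1)| ≤ 1 / 2 + eps (2 * m + 1) ε i := by
  have h0 : 0 ≤ eps (2 * m + 1) ε i := by
    rw [eps_of_lt ε hi]
    positivity
  rw [req_sub_piB m ε hi.le, abs_le]
  split_ifs <;> constructor <;> linarith

theorem cost_piB_le (m : ℕ) {ε : ℝ} (hε : 0 ≤ ε) :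
    cost (2 * m + 1) ε (piB (2 * m + 1)) ≤ m + ε / 8 := by
  have hlast : |req (2 * m + 1) ε (2 * m + 1) - ((piB (2 * m + 1) (2 * m + 1) : ℝ) - 1)| = 0 := by
    rw [req_sub_piB m ε le_rfl, if_pos (by omega), eps, if_pos rfl, sub_self, abs_zero]
  rw [cost, Finset.sum_Icc_succ_top (by omega), hlast, add_zero]
  calc _ ≤ ∑ i ∈ Finset.Icc 1 (2 * m), (1 / 2 + eps (2 * m + 1) ε i) :=
        Finset.sum_le_sum fun i hi =>
          abs_req_sub_piB_le m hε (Nat.lt_succ_of_le (Finset.mem_Icc.1 hi).2)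
    _ = m + ∑ i ∈ Finset.Icc 1 (2 * m), eps (2 * m + 1) ε i := by
        rw [Finset.sum_add_distrib, Finset.sum_const, Nat.card_Icc, nsmul_eq_mul]
        push_cast [Nat.add_sub_cancel]
        ring
    _ ≤ m + ε / 8 := by
        gcongr
        exact sum_eps_le _ hε

theorem bijOn_piB (m : ℕ) :
    Set.BijOn (piB (2 * m + 1)) (Set.Icc 1 (2 * m + 1)) (Set.Icc 1 (2 * m + 1)) := by
  refine ⟨fun i hi => ?_, fun i hi j hj hij => ?_, fun s hs => ?_⟩
  · simp only [Set.mem_Icc, piB] at *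
    split_ifs <;> omega
  · simp only [Set.mem_Icc, piB] at *
    split_ifs at hij <;> omega
  · simp only [Set.mem_Icc, Set.mem_image, piB] at *
    rcases lt_or_ge m s with h | h
    · refine ⟨2 * (s - m) - 1, by omega, ?_⟩
      split_ifs <;> omega
    · refine ⟨2 * (m + 1 - s), by omega, ?_⟩
      split_ifs <;> omega

theorem cost_nonneg (k : ℕ) (ε : ℝ) (f : ℕ → ℕ) : 0 ≤ cost k ε f :=
  Finset.sum_nonneg fun _ _ => abs_nonneg _

/-- Odd case: C(π_B) ≤ (k-1)/2 + ε/8, hence the minimum cost over all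
bijections of {1,...,k} is at most (k-1)/2 + ε/8. -/
theorem odd_offCost_upper (k : ℕ) (hk : 3 ≤ k) (hko : Odd k)
    (ε : ℝ) (hε : 0 < ε) (hε1 : ε ≤ 1) :
    cost k ε (piB k) ≤ ((k : ℝ) - 1) / 2 + ε / 8 ∧
      sInf {c : ℝ | ∃ g : ℕ → ℕ,
          Set.BijOn g (Set.Icc 1 k) (Set.Icc 1 k) ∧ c = cost k ε g} ≤
        ((k : ℝ) - 1) / 2 + ε / 8 := by
  obtain ⟨m, rfl⟩ := hko
  have hk2 : (((2 * m + 1 : ℕ) : ℝ) - 1) / 2 = m := by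
    push_cast
    ring
  rw [hk2]
  refine ⟨cost_piB_le m hε.le, (csInf_le ⟨0, ?_⟩ ?_).trans (cost_piB_le m hε.le)⟩
  · rintro _ ⟨g, -, rfl⟩
    exact cost_nonneg _ _ _
  · exact ⟨_, bijOn_piB m, rfl⟩
end

section
/- Under the odd-case construction, for each i ∈ {1,...,k}, every injection f : {1,...,i} → {1,...,k} that minimizes Σ_{j=1}^i |r_j - (f(j)-1)| over all injections of {1,...,i} into {1,...,k} has image exactly {(k+1)/2 - ⌈i/2⌉ + 1, (k+1)/2 - ⌈i/2⌉ + 2, ..., (k+1)/2 + ⌊i/2⌋}. -/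
/-- If a potential `φ` certifies that `g` is optimal and separates the image of `g` (where it is
negative) from the remaining points of `B`, then every injection that costs no more than `g` has
the same image as `g`. -/
theorem image_eq_of_potential {α β : Type*} [DecidableEq β] (A : Finset α) (B : Set β)
    (c : α → β → ℝ) (φ : β → ℝ) (f g : α → β)
    (hfB : ∀ a ∈ A, f a ∈ B) (hf : Set.InjOn f A) (hg : Set.InjOn g A)
    (hle : ∑ a ∈ A, c a (f a) ≤ ∑ a ∈ A, c a (g a))
    (hφ : ∀ a ∈ A, ∀ b ∈ B, φ b - φ (g a) ≤ c a b - c a (g a))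
    (hneg : ∀ a ∈ A, φ (g a) < 0)
    (hnonneg : ∀ b ∈ B, b ∉ A.image g → 0 ≤ φ b) :
    A.image f = A.image g := by
  have hsum : ∑ b ∈ A.image f, φ b ≤ ∑ b ∈ A.image g, φ b := by
    rw [Finset.sum_image hf, Finset.sum_image hg]
    have h := Finset.sum_le_sum fun a ha => hφ a ha (f a) (hfB a ha)
    simp only [Finset.sum_sub_distrib] at h
    linarith
  have hcard : (A.image f).card = (A.image g).card := by
    rw [Finset.card_image_of_injOn hf, Finset.card_image_of_injOn hg]
  by_contra hne
  have hsub : ¬ A.image g ⊆ A.image f := fun h =>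
    hne (Finset.eq_of_subset_of_card_le h hcard.le).symm
  have hlt : ∑ b ∈ A.image g \ A.image f, φ b < 0 := by
    refine Finset.sum_neg (fun b hb => ?_) (Finset.sdiff_nonempty.2 hsub)
    obtain ⟨a, ha, rfl⟩ := Finset.mem_image.1 (Finset.mem_sdiff.1 hb).1
    exact hneg a ha
  have hge : 0 ≤ ∑ b ∈ A.image f \ A.image g, φ b := by
    refine Finset.sum_nonneg fun b hb => ?_
    obtain ⟨hbf, hbg⟩ := Finset.mem_sdiff.1 hb
    obtain ⟨a, ha, rfl⟩ := Finset.mem_image.1 hbf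
    exact hnonneg _ (hfB a ha) hbg
  have h₁ := Finset.sum_inter_add_sum_sdiff (A.image f) (A.image g) φ
  have h₂ := Finset.sum_inter_add_sum_sdiff (A.image g) (A.image f) φ
  rw [Finset.inter_comm] at h₂
  linarith

theorem abs_sub_le_sub_of_step {φ : ℕ → ℝ} (hφ : ∀ s, |φ (s + 1) - φ s| ≤ 1) {s t : ℕ}
    (hst : s ≤ t) : |φ t - φ s| ≤ (t : ℝ) - s := by
  induction t, hst using Nat.le_induction with
  | base => simp
  | succ t _ ih =>
    have h := abs_add_le (φ (t + 1) - φ t) (φ t - φ s)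
    rw [sub_add_sub_cancel] at h
    push_cast
    linarith [hφ t]

/-- A request `r` between servers `q` and `q + 1` is served at least as well by `q + 1` as by any
other server, once costs are corrected by the potential `φ`. -/
theorem potential_sub_le_right {φ : ℕ → ℝ} (hφ : ∀ s, |φ (s + 1) - φ s| ≤ 1) {q : ℕ} {r : ℝ}
    (hr : r ≤ q) (hq : φ q - φ (q + 1) ≤ 2 * (r - ((q : ℝ) - 1)) - 1) (s : ℕ) :
    φ s - φ (q + 1) ≤ |r - ((s : ℝ) - 1)| - |r - (((q + 1 : ℕ) : ℝ) - 1)| := by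
  have hqr : |r - (((q + 1 : ℕ) : ℝ) - 1)| = q - r := by
    push_cast
    rw [abs_of_nonpos (by linarith)]
    ring
  rw [hqr]
  rcases le_or_gt s q with h | h
  · have h₁ := abs_le.1 (abs_sub_le_sub_of_step hφ h)
    linarith [le_abs_self (r - ((s : ℝ) - 1)), h₁.1]
  · have h₁ := abs_le.1 (abs_sub_le_sub_of_step hφ (Nat.succ_le_of_lt h))
    push_cast at h₁
    linarith [neg_abs_le (r - ((s : ℝ) - 1)), h₁.2]

/-- The counterpart of `potential_sub_le_right` for the left neighbour. -/
theorem potential_sub_le_left {φ : ℕ → ℝ} (hφ : ∀ s, |φ (s + 1) - φ s| ≤ 1) {q : ℕ} {r : ℝ}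
    (hr : (q : ℝ) - 1 ≤ r) (hq : φ (q + 1) - φ q ≤ 1 - 2 * (r - ((q : ℝ) - 1))) (s : ℕ) :
    φ s - φ q ≤ |r - ((s : ℝ) - 1)| - |r - ((q : ℝ) - 1)| := by
  rw [abs_of_nonneg (sub_nonneg.2 hr)]
  rcases le_or_gt s q with h | h
  · have h₁ := abs_le.1 (abs_sub_le_sub_of_step hφ h)
    linarith [le_abs_self (r - ((s : ℝ) - 1)), h₁.1]
  · have h₁ := abs_le.1 (abs_sub_le_sub_of_step hφ (Nat.succ_le_of_lt h))
    push_cast at h₁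
    linarith [neg_abs_le (r - ((s : ℝ) - 1)), h₁.2]

/-- The potential certifying the optimal matching of the first `2 * a` requests, where `e` stands
for the sequence of perturbations. -/
noncomputable def evenPotential (e : ℕ → ℝ) (m a s : ℕ) : ℝ :=
  if s + a ≤ m + 1 then (m : ℝ) + 1 - a - s
  else if s ≤ m then -2 * e (2 * a)
  else if s ≤ m + 1 + a then -2 * e (2 * a) + 3 / 2 * e (2 * (s - (m + 1)))
  else (s : ℝ) - m - 1 - a - e (2 * a) / 2

/-- The potential certifying the optimal matching of the first `2 * a + 1` requests. -/
noncomputable def oddPotential (e : ℕ → ℝ) (m a s : ℕ) : ℝ :=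
  if m + a + 2 ≤ s then (s : ℝ) - m - a - 2
  else if m + 2 ≤ s then -2 * e (2 * a + 1)
  else if m + 1 ≤ s + a then -2 * e (2 * a + 1) + 3 / 2 * e (2 * (m + 1 - s) + 1)
  else (m : ℝ) + 1 - a - s - e (2 * a + 1) / 2

section Potential

variable {e : ℕ → ℝ} {m a : ℕ}

theorem le_of_doubling (he : ∀ n, 0 < e n) (hs : ∀ n, e (n + 1) = 2 * e n) {n p : ℕ}
    (h : n ≤ p) : e n ≤ e p :=
  monotone_nat_of_le_succ (fun n => by rw [hs]; linarith [he n]) h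

theorem abs_evenPotential_step_le (he : ∀ n, 0 < e n) (hs : ∀ n, e (n + 1) = 2 * e n)
    (ha : e (2 * a) ≤ 1 / 8) (s : ℕ) :
    |evenPotential e m a (s + 1) - evenPotential e m a s| ≤ 1 := by
  have hpos := he (2 * a)
  have h₁ : s ≤ m + a → 0 < e (2 * (s + 1 - (m + 1))) ∧ e (2 * (s + 1 - (m + 1))) ≤ e (2 * a) :=
    fun h => ⟨he _, le_of_doubling he hs (by omega)⟩
  have h₂ : s ≤ m + 1 + a → 0 < e (2 * (s - (m + 1))) ∧ e (2 * (s - (m + 1))) ≤ e (2 * a) :=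
    fun h => ⟨he _, le_of_doubling he hs (by omega)⟩
  have h₃ : s = m + 1 + a → e (2 * (s - (m + 1))) = e (2 * a) := by
    rintro rfl
    congr 2
    omega
  have h₄ : s + a ≤ m + 1 → ¬ s + 1 + a ≤ m + 1 → (s : ℝ) + a = m + 1 := fun h h' => by
    exact_mod_cast (by omega : s + a = m + 1)
  have h₅ : s ≤ m + 1 + a → ¬ s + 1 ≤ m + 1 + a → (s : ℝ) = m + 1 + a := fun h h' => by
    exact_mod_cast (by omega : s = m + 1 + a)
  rw [abs_le]
  unfold evenPotential
  push_cast
  split_ifs <;> grind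

theorem abs_oddPotential_step_le (he : ∀ n, 0 < e n) (hs : ∀ n, e (n + 1) = 2 * e n)
    (ha : e (2 * a + 1) ≤ 1 / 8) (s : ℕ) :
    |oddPotential e m a (s + 1) - oddPotential e m a s| ≤ 1 := by
  have hpos := he (2 * a + 1)
  have h₁ : m + 1 ≤ s + 1 + a → 0 < e (2 * (m + 1 - (s + 1)) + 1) ∧
      e (2 * (m + 1 - (s + 1)) + 1) ≤ e (2 * a + 1) :=
    fun h => ⟨he _, le_of_doubling he hs (by omega)⟩
  have h₂ : m + 1 ≤ s + a → 0 < e (2 * (m + 1 - s) + 1) ∧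
      e (2 * (m + 1 - s) + 1) ≤ e (2 * a + 1) :=
    fun h => ⟨he _, le_of_doubling he hs (by omega)⟩
  have h₃ : s + 1 + a = m + 1 → e (2 * (m + 1 - (s + 1)) + 1) = e (2 * a + 1) := by
    intro h
    congr 3
    omega
  have h₄ : m + a + 2 ≤ s + 1 → ¬ m + a + 2 ≤ s → (s : ℝ) = m + a + 1 := fun h h' => by
    exact_mod_cast (by omega : s = m + a + 1)
  have h₅ : m + 1 ≤ s + 1 + a → ¬ m + 1 ≤ s + a → (s : ℝ) + 1 + a = m + 1 := fun h h' => by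
    exact_mod_cast (by omega : s + 1 + a = m + 1)
  rw [abs_le]
  unfold oddPotential
  push_cast
  split_ifs <;> grind

/-- Between servers `m + 1 + l` and `m + 2 + l` lies the request of index `2 * l + 1`. -/
theorem evenPotential_increase (he : ∀ n, 0 < e n) (hs : ∀ n, e (n + 1) = 2 * e n) {l : ℕ}
    (hl : l < a) :
    evenPotential e m a (m + 1 + l) - evenPotential e m a (m + 1 + l + 1) ≤
      -2 * e (2 * l + 1) := by
  have h₁ : e (2 * (m + 1 + l + 1 - (m + 1))) = 4 * e (2 * l) := by
    rw [show 2 * (m + 1 + l + 1 - (m + 1)) = 2 * l + 1 + 1 by omega, hs, hs]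
    ring
  have h₂ := hs (2 * l)
  have h₃ := he (2 * l)
  unfold evenPotential
  rw [if_neg (by omega), if_neg (by omega), if_pos (by omega), if_neg (by omega),
    if_neg (by omega), if_pos (by omega), h₁, Nat.add_sub_cancel_left]
  linarith

/-- Between servers `q` and `q + 1` with `q + l = m + 1` lies the request of index `2 * l`. -/
theorem evenPotential_decrease (he : ∀ n, 0 < e n) {l q : ℕ} (hl : 1 ≤ l) (hla : l ≤ a)
    (hq : q + l = m + 1) :
    evenPotential e m a q - evenPotential e m a (q + 1) ≤ 2 * e (2 * l) := by
  have h₁ := he (2 * l)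
  have h₂ := he (2 * (q + 1 - (m + 1)))
  have h₃ : q + a ≤ m + 1 → (q : ℝ) + a = m + 1 ∧ l = a := fun h =>
    ⟨by exact_mod_cast (by omega : q + a = m + 1), by omega⟩
  unfold evenPotential
  push_cast
  split_ifs <;> grind

theorem oddPotential_decrease (he : ∀ n, 0 < e n) (hs : ∀ n, e (n + 1) = 2 * e n) {l q : ℕ}
    (hl : 1 ≤ l) (hla : l ≤ a) (hq : q + l = m + 1) :
    oddPotential e m a (q + 1) - oddPotential e m a q ≤ -2 * e (2 * l) := by
  have h₁ : e (2 * (m + 1 - q) + 1) = 2 * e (2 * l) := by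
    rw [show 2 * (m + 1 - q) + 1 = 2 * l + 1 by omega, hs]
  have h₂ : e (2 * l) = 2 * e (2 * (m + 1 - (q + 1)) + 1) := by
    rw [← hs]
    congr 1
    omega
  have h₃ := he (2 * (m + 1 - (q + 1)) + 1)
  unfold oddPotential
  rw [if_neg (by omega), if_neg (by omega), if_pos (by omega), if_neg (by omega),
    if_neg (by omega), if_pos (by omega), h₁]
  linarith

theorem oddPotential_increase (he : ∀ n, 0 < e n) {l : ℕ} (hla : l ≤ a) :
    oddPotential e m a (m + 1 + l + 1) - oddPotential e m a (m + 1 + l) ≤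
      2 * e (2 * l + 1) := by
  have h₁ := he (2 * l + 1)
  have h₂ := he (2 * (m + 1 - (m + 1 + l)) + 1)
  have h₃ : m + a + 2 ≤ m + 1 + l + 1 → (l : ℝ) = a ∧ l = a := fun h =>
    ⟨by exact_mod_cast (by omega : l = a), by omega⟩
  unfold oddPotential
  push_cast
  split_ifs <;> grind

theorem evenPotential_neg (he : ∀ n, 0 < e n) (hs : ∀ n, e (n + 1) = 2 * e n) {s : ℕ}
    (h₁ : m + 1 < s + a) (h₂ : s ≤ m + 1 + a) : evenPotential e m a s < 0 := by
  have hpos := he (2 * a)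
  have hle : e (2 * (s - (m + 1))) ≤ e (2 * a) := le_of_doubling he hs (by omega)
  unfold evenPotential
  rw [if_neg (by omega)]
  split_ifs <;> linarith

theorem oddPotential_neg (he : ∀ n, 0 < e n) (hs : ∀ n, e (n + 1) = 2 * e n) {s : ℕ}
    (h₁ : m + 1 ≤ s + a) (h₂ : s ≤ m + 1 + a) : oddPotential e m a s < 0 := by
  have hpos := he (2 * a + 1)
  have hle : e (2 * (m + 1 - s) + 1) ≤ e (2 * a + 1) := le_of_doubling he hs (by omega)
  unfold oddPotential
  rw [if_neg (by omega)]
  split_ifs <;> linarith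

theorem evenPotential_nonneg (ha : e (2 * a) ≤ 1 / 8) {s : ℕ}
    (h : s + a ≤ m + 1 ∨ m + 1 + a < s) : 0 ≤ evenPotential e m a s := by
  unfold evenPotential
  rcases h with h | h
  · rw [if_pos h]
    have : (s : ℝ) + a ≤ m + 1 := by exact_mod_cast h
    linarith
  · rw [if_neg (by omega), if_neg (by omega), if_neg (by omega)]
    have : (m : ℝ) + 1 + a + 1 ≤ s := by exact_mod_cast h
    linarith

theorem oddPotential_nonneg (ha : e (2 * a + 1) ≤ 1 / 8) {s : ℕ}
    (h : s + a < m + 1 ∨ m + 1 + a < s) : 0 ≤ oddPotential e m a s := by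
  unfold oddPotential
  rcases h with h | h
  · rw [if_neg (by omega), if_neg (by omega), if_neg (by omega)]
    have : (s : ℝ) + a + 1 ≤ m + 1 := by exact_mod_cast h
    linarith
  · rw [if_pos (by omega)]
    have : (m : ℝ) + 1 + a + 1 ≤ s := by exact_mod_cast h
    linarith

end Potential

theorem req_odd_of_lt (ε : ℝ) {m l : ℕ} (h : 2 * l + 1 < 2 * m + 1) :
    req (2 * m + 1) ε (2 * l + 1) =
      m + l + 1 / 2 - ε / 8 * (2 : ℝ) ^ (((2 * l + 1 : ℕ) : ℤ) - ((2 * m + 1 : ℕ) : ℤ)) := by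
  unfold req eps
  rw [if_pos (by omega), if_neg (by omega), show (2 * l + 1 + 1) / 2 = l + 1 by omega]
  push_cast
  ring

theorem req_even (ε : ℝ) (m l : ℕ) :
    req (2 * m + 1) ε (2 * l) =
      m - l + 1 / 2 + ε / 8 * (2 : ℝ) ^ (((2 * l : ℕ) : ℤ) - ((2 * m + 1 : ℕ) : ℤ)) := by
  unfold req eps
  rw [if_neg (by omega), if_neg (by omega), show 2 * l / 2 = l by omega]
  push_cast
  ring

theorem piB_odd (m l : ℕ) : piB (2 * m + 1) (2 * l + 1) = m + 1 + l := by
  unfold piB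
  rw [if_pos (by omega)]
  omega

theorem piB_even_add {m l : ℕ} (h : l ≤ m) : piB (2 * m + 1) (2 * l) + l = m + 1 := by
  unfold piB
  rw [if_neg (by omega)]
  omega

theorem piB_injOn (m : ℕ) : Set.InjOn (piB (2 * m + 1)) (Set.Icc 1 (2 * m + 1)) := by
  rintro x ⟨hx₁, hx₂⟩ y ⟨hy₁, hy₂⟩ h
  unfold piB at h
  split_ifs at h <;> omega

theorem image_piB_odd {m a : ℕ} (ha : a ≤ m) :
    (Finset.Icc 1 (2 * a + 1)).image (piB (2 * m + 1)) =
      Finset.Icc (m + 1 - a) (m + 1 + a) := by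
  refine Finset.eq_of_subset_of_card_le (fun x hx => ?_) ?_
  · obtain ⟨j, hj, rfl⟩ := Finset.mem_image.1 hx
    rw [Finset.mem_Icc] at hj ⊢
    unfold piB
    split_ifs <;> omega
  · rw [Finset.card_image_of_injOn ((piB_injOn m).mono fun x hx => ?_)]
    · simp only [Nat.card_Icc]
      omega
    · simp only [Finset.coe_Icc, Set.mem_Icc] at hx ⊢
      omega

theorem image_piB_even_succ {m a : ℕ} (ha : a ≤ m) :
    (Finset.Icc 1 (2 * a)).image (fun j => piB (2 * m + 1) j + 1) =
      Finset.Icc (m + 2 - a) (m + 1 + a) := by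
  refine Finset.eq_of_subset_of_card_le (fun x hx => ?_) ?_
  · obtain ⟨j, hj, rfl⟩ := Finset.mem_image.1 hx
    rw [Finset.mem_Icc] at hj ⊢
    unfold piB
    split_ifs <;> omega
  · rw [Finset.card_image_of_injOn]
    · simp only [Nat.card_Icc]
      omega
    · intro x hx y hy h
      simp only [Finset.coe_Icc, Set.mem_Icc] at hx hy
      exact piB_injOn m ⟨hx.1, by omega⟩ ⟨hy.1, by omega⟩ (Nat.succ_injective h)

section Perturbation

variable {ε : ℝ}

theorem perturbation_pos (hε : 0 < ε) (k n : ℕ) :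
    0 < ε / 8 * (2 : ℝ) ^ ((n : ℤ) - (k : ℤ)) := by positivity

theorem perturbation_succ (ε : ℝ) (k n : ℕ) :
    ε / 8 * (2 : ℝ) ^ (((n + 1 : ℕ) : ℤ) - (k : ℤ)) =
      2 * (ε / 8 * (2 : ℝ) ^ ((n : ℤ) - (k : ℤ))) := by
  rw [show ((n + 1 : ℕ) : ℤ) - (k : ℤ) = (n : ℤ) - k + 1 by push_cast; ring,
    zpow_add_one₀ two_ne_zero]
  ring

theorem perturbation_le (hε : 0 < ε) (hε1 : ε ≤ 1) {k n : ℕ} (h : n ≤ k) :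
    ε / 8 * (2 : ℝ) ^ ((n : ℤ) - (k : ℤ)) ≤ 1 / 8 := by
  have h₁ : (2 : ℝ) ^ ((n : ℤ) - (k : ℤ)) ≤ 1 := zpow_le_one_of_nonpos₀ one_le_two (by omega)
  nlinarith

theorem evenPotential_sub_le (hε : 0 < ε) (hε1 : ε ≤ 1) {m a : ℕ} (ha : a ≤ m) {j : ℕ}
    (hj : j ∈ Finset.Icc 1 (2 * a)) (s : ℕ) :
    let φ := evenPotential (fun n => ε / 8 * (2 : ℝ) ^ ((n : ℤ) - ((2 * m + 1 : ℕ) : ℤ))) m a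
    φ s - φ (piB (2 * m + 1) j + 1) ≤ |req (2 * m + 1) ε j - ((s : ℝ) - 1)| -
      |req (2 * m + 1) ε j - (((piB (2 * m + 1) j + 1 : ℕ) : ℝ) - 1)| := by
  intro φ
  have hpos := perturbation_pos hε (2 * m + 1)
  have hsucc := perturbation_succ ε (2 * m + 1)
  have hstep := abs_evenPotential_step_le (m := m) (a := a) hpos hsucc
    (perturbation_le hε hε1 (by omega))
  rw [Finset.mem_Icc] at hj
  have hle := perturbation_le hε hε1 (show j ≤ 2 * m + 1 by omega)
  have hj0 := hpos j
  rcases Nat.even_or_odd' j with ⟨l, rfl | rfl⟩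
  · have hq := piB_even_add (m := m) (l := l) (by omega)
    have hdec := evenPotential_decrease hpos (by omega) (by omega : l ≤ a) hq
    have hqR : (piB (2 * m + 1) (2 * l) : ℝ) + l = m + 1 := by exact_mod_cast hq
    have hr := req_even ε m l
    exact potential_sub_le_right hstep (by linarith) (by linarith) s
  · have hinc := evenPotential_increase (m := m) hpos hsucc (by omega : l < a)
    have hr := req_odd_of_lt ε (show 2 * l + 1 < 2 * m + 1 by omega)
    rw [piB_odd]
    refine potential_sub_le_right hstep ?_ ?_ s
    · push_cast at hr hj0 ⊢
      linarith
    · push_cast at hr hinc ⊢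
      linarith

theorem oddPotential_sub_le (hε : 0 < ε) (hε1 : ε ≤ 1) {m a : ℕ} (ha : a < m) {j : ℕ}
    (hj : j ∈ Finset.Icc 1 (2 * a + 1)) (s : ℕ) :
    let φ := oddPotential (fun n => ε / 8 * (2 : ℝ) ^ ((n : ℤ) - ((2 * m + 1 : ℕ) : ℤ))) m a
    φ s - φ (piB (2 * m + 1) j) ≤ |req (2 * m + 1) ε j - ((s : ℝ) - 1)| -
      |req (2 * m + 1) ε j - ((piB (2 * m + 1) j : ℝ) - 1)| := by
  intro φ
  have hpos := perturbation_pos hε (2 * m + 1)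
  have hsucc := perturbation_succ ε (2 * m + 1)
  have hstep := abs_oddPotential_step_le (m := m) (a := a) hpos hsucc
    (perturbation_le hε hε1 (by omega))
  rw [Finset.mem_Icc] at hj
  have hle := perturbation_le hε hε1 (show j ≤ 2 * m + 1 by omega)
  have hj0 := hpos j
  rcases Nat.even_or_odd' j with ⟨l, rfl | rfl⟩
  · have hq := piB_even_add (m := m) (l := l) (by omega)
    have hdec := oddPotential_decrease hpos hsucc (by omega) (by omega : l ≤ a) hq
    have hqR : (piB (2 * m + 1) (2 * l) : ℝ) + l = m + 1 := by exact_mod_cast hq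
    have hr := req_even ε m l
    exact potential_sub_le_left hstep (by linarith) (by linarith) s
  · have hinc := oddPotential_increase (m := m) hpos (by omega : l ≤ a)
    have hr := req_odd_of_lt ε (show 2 * l + 1 < 2 * m + 1 by omega)
    rw [piB_odd]
    refine potential_sub_le_left hstep ?_ ?_ s
    · push_cast at hr hle ⊢
      linarith
    · push_cast at hr hinc ⊢
      linarith

end Perturbation

/-- Odd case: for each i ∈ {1,...,k}, every injection f : {1,...,i} → {1,...,k}
minimizing ∑_{j=1}^i |r_j - (f j - 1)| has image exactly
{(k+1)/2 - ⌈i/2⌉ + 1, ..., (k+1)/2 + ⌊i/2⌋}. -/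
theorem odd_opt_prefix_image (k : ℕ) (hk : 3 ≤ k) (hko : Odd k)
    (ε : ℝ) (hε : 0 < ε) (hε1 : ε ≤ 1)
    (i : ℕ) (hi : 1 ≤ i) (hik : i ≤ k)
    (f : ℕ → ℕ) (hmap : Set.MapsTo f (Set.Icc 1 i) (Set.Icc 1 k))
    (hinj : Set.InjOn f (Set.Icc 1 i))
    (hopt : ∀ f' : ℕ → ℕ, Set.MapsTo f' (Set.Icc 1 i) (Set.Icc 1 k) →
      Set.InjOn f' (Set.Icc 1 i) →
      ∑ j ∈ Finset.Icc 1 i, |req k ε j - ((f j : ℝ) - 1)| ≤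
        ∑ j ∈ Finset.Icc 1 i, |req k ε j - ((f' j : ℝ) - 1)|) :
    f '' Set.Icc 1 i =
      Set.Icc ((k + 1) / 2 - (i + 1) / 2 + 1) ((k + 1) / 2 + i / 2) := by
  obtain ⟨m, rfl⟩ := hko
  have hfA : ∀ j ∈ Finset.Icc 1 i, f j ∈ Set.Icc 1 (2 * m + 1) := fun j hj =>
    hmap (Finset.mem_Icc.1 hj)
  have hfinj : Set.InjOn f (Finset.Icc 1 i : Finset ℕ) := by rwa [Finset.coe_Icc]
  rw [← Finset.coe_Icc, ← Finset.coe_Icc, ← Finset.coe_image]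
  congr 1
  rcases Nat.even_or_odd' i with ⟨a, rfl | rfl⟩
  · have ha : a ≤ m := by omega
    rw [show (2 * m + 1 + 1) / 2 - (2 * a + 1) / 2 + 1 = m + 2 - a by omega,
      show (2 * m + 1 + 1) / 2 + 2 * a / 2 = m + 1 + a by omega, ← image_piB_even_succ ha]
    have hmem : ∀ j ∈ Finset.Icc 1 (2 * a),
        piB (2 * m + 1) j + 1 ∈ Finset.Icc (m + 2 - a) (m + 1 + a) := fun j hj => by
      rw [← image_piB_even_succ ha]
      exact Finset.mem_image_of_mem _ hj
    have hginj : Set.InjOn (fun j => piB (2 * m + 1) j + 1) (Set.Icc 1 (2 * a)) :=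
      fun x hx y hy h =>
        piB_injOn m ⟨hx.1, hx.2.trans hik⟩ ⟨hy.1, hy.2.trans hik⟩ (Nat.succ_injective h)
    refine image_eq_of_potential _ (Set.Icc 1 (2 * m + 1))
      (fun j s => |req (2 * m + 1) ε j - ((s : ℝ) - 1)|)
      (evenPotential (fun n => ε / 8 * (2 : ℝ) ^ ((n : ℤ) - ((2 * m + 1 : ℕ) : ℤ))) m a)
      f _ hfA hfinj (by rwa [Finset.coe_Icc]) (hopt _ (fun j hj => ?_) hginj)
      (fun j hj s _ => evenPotential_sub_le hε hε1 ha hj s) (fun j hj => ?_)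
      (fun s _ hs => ?_)
    · have h := Finset.mem_Icc.1 (hmem j (Finset.mem_Icc.2 hj))
      exact ⟨by omega, by omega⟩
    · have h := Finset.mem_Icc.1 (hmem j hj)
      exact evenPotential_neg (perturbation_pos hε _) (perturbation_succ ε _) (by omega) h.2
    · rw [image_piB_even_succ ha, Finset.mem_Icc] at hs
      exact evenPotential_nonneg (perturbation_le hε hε1 (by omega)) (by omega)
  · have ha : a ≤ m := by omega
    rw [show (2 * m + 1 + 1) / 2 - (2 * a + 1 + 1) / 2 + 1 = m + 1 - a by omega,
      show (2 * m + 1 + 1) / 2 + (2 * a + 1) / 2 = m + 1 + a by omega]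
    rcases ha.eq_or_lt with rfl | ham
    · refine Finset.eq_of_subset_of_card_le (fun x hx => ?_) ?_
      · obtain ⟨j, hj, rfl⟩ := Finset.mem_image.1 hx
        have h := hfA j hj
        rw [Set.mem_Icc] at h
        rw [Finset.mem_Icc]
        omega
      · rw [Finset.card_image_of_injOn hfinj]
        simp only [Nat.card_Icc]
        omega
    rw [← image_piB_odd ha]
    have hmem : ∀ j ∈ Finset.Icc 1 (2 * a + 1),
        piB (2 * m + 1) j ∈ Finset.Icc (m + 1 - a) (m + 1 + a) := fun j hj => by
      rw [← image_piB_odd ha]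
      exact Finset.mem_image_of_mem _ hj
    have hginj : Set.InjOn (piB (2 * m + 1)) (Set.Icc 1 (2 * a + 1)) :=
      (piB_injOn m).mono (Set.Icc_subset_Icc_right hik)
    refine image_eq_of_potential _ (Set.Icc 1 (2 * m + 1))
      (fun j s => |req (2 * m + 1) ε j - ((s : ℝ) - 1)|)
      (oddPotential (fun n => ε / 8 * (2 : ℝ) ^ ((n : ℤ) - ((2 * m + 1 : ℕ) : ℤ))) m a)
      f _ hfA hfinj (by rwa [Finset.coe_Icc]) (hopt _ (fun j hj => ?_) hginj)
      (fun j hj s _ => oddPotential_sub_le hε hε1 ham hj s) (fun j hj => ?_)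
      (fun s _ hs => ?_)
    · have h := Finset.mem_Icc.1 (hmem j (Finset.mem_Icc.2 hj))
      exact ⟨by omega, by omega⟩
    · have h := Finset.mem_Icc.1 (hmem j hj)
      exact oddPotential_neg (perturbation_pos hε _) (perturbation_succ ε _) (by omega) h.2
    · rw [image_piB_odd ha, Finset.mem_Icc] at hs
      exact oddPotential_nonneg (perturbation_le hε hε1 (by omega)) (by omega)
end
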